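/- arXiv:1503.07598 — 2 statements merged into one kernel-verified Lean document; each statement's English description precedes it below -/
import Mathlib

section
/- Let n ≥ 2 and let D be an n×n diagonal matrix with complex entries d₁,…,dₙ satisfying d₁ + ⋯ + dₙ = 0. Define ψ_D on the space 𝔭 of traceless Hermitian n×n complex matrices by ψ_D(Y) = ∫_{SU(n)} exp(i · tr(D · (u Y u⁻¹))) dμ(u). Then ψ_D is a bounded function on 𝔭 if and only if all the entries d₁,…,dₙ are real. (This is the paper's main theorem — boundedness of the spherical function ψ_λ on the Cartan motion group of a complex semisimple group exactly when λ is real — instantiated for G = SL(n,ℂ), K = SU(n), 𝔭 = traceless Hermitian matrices, 𝔞 = real diagonal traceless matrices, with λ ∈ 𝔞*_ℂ corresponding to the complex diagonal traceless matrix D via the trace form.) -/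
open MeasureTheory

lemma aux_gauss_integrable (n : ℕ) (b : Fin n → ℂ) (hb : ∀ j, 0 < (b j).re) :
    Integrable (fun w : Fin n → ℂ => ∏ j, Complex.exp (-b j * ‖w j‖ ^ 2)) := by
  refine Integrable.fintype_prod (f := fun j (x : ℂ) => Complex.exp (-b j * ‖x‖ ^ 2)) fun j => ?_
  simpa using GaussianFourier.integrable_cexp_neg_mul_sq_norm_add (hb j) 0 (0 : ℂ)

lemma aux_gauss_integral (n : ℕ) (b : Fin n → ℂ) (hb : ∀ j, 0 < (b j).re) :
    ∫ w : Fin n → ℂ, ∏ j, Complex.exp (-b j * ‖w j‖ ^ 2) = ∏ j, (Real.pi / b j : ℂ) := by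
  rw [integral_fintype_prod_volume_eq_prod (fun j (x : ℂ) => Complex.exp (-b j * ‖x‖ ^ 2))]
  refine Finset.prod_congr rfl fun j _ => ?_
  rw [GaussianFourier.integral_cexp_neg_mul_sq_norm (hb j)]
  simp

lemma aux_exp_integrable (n : ℕ) (a : ℝ) (ha : 0 < a) :
    Integrable (fun w : Fin n → ℂ => Real.exp (-a * ∑ j, ‖w j‖ ^ 2)) := by
  have := (aux_gauss_integrable n (fun _ => (a : ℂ)) (fun _ => by simpa using ha)).norm
  refine this.congr (Filter.Eventually.of_forall fun w => ?_)
  simp only [← Complex.exp_sum, Complex.norm_exp, Finset.mul_sum]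
  congr 1
  simp [← Complex.ofReal_pow, ← Complex.ofReal_neg]

lemma aux_mp (n : ℕ) (A : Matrix (Fin n) (Fin n) ℂ) (hA : A.det = 1) :
    MeasurePreserving (fun w : Fin n → ℂ => A.mulVec w) := by
  have hdet : LinearMap.det ((Matrix.toLin' A).restrictScalars ℝ) = 1 := by
    rw [LinearMap.det_restrictScalars]
    simp [hA]
  refine ⟨by fun_prop, ?_⟩
  have := Measure.map_linearMap_addHaar_eq_smul_addHaar (volume : Measure (Fin n → ℂ))
    (f := (Matrix.toLin' A).restrictScalars ℝ) (by rw [hdet]; simp)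
  rw [hdet] at this
  have h2 : (fun w : Fin n → ℂ => A.mulVec w) = ⇑((Matrix.toLin' A).restrictScalars ℝ) := by
    ext w; simp
  rw [h2, this]
  simp

lemma aux_norm (n : ℕ) (A : Matrix (Fin n) (Fin n) ℂ) (hA : A.conjTranspose * A = 1)
    (w : Fin n → ℂ) : ∑ j, ‖A.mulVec w j‖ ^ 2 = ∑ j, ‖w j‖ ^ 2 := by
  have key : ∀ v : Fin n → ℂ, ((∑ j, ‖v j‖ ^ 2 : ℝ) : ℂ) = star v ⬝ᵥ v := by
    intro v
    simp [dotProduct, Complex.conj_mul']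
  have : ((∑ j, ‖A.mulVec w j‖ ^ 2 : ℝ) : ℂ) = ((∑ j, ‖w j‖ ^ 2 : ℝ) : ℂ) := by
    rw [key, key, Matrix.star_mulVec, Matrix.dotProduct_mulVec, Matrix.vecMul_vecMul, hA,
      Matrix.vecMul_one]
  exact_mod_cast this

lemma aux_trace (n : ℕ) (hn : n ≠ 0) (d : Fin n → ℂ) (hd : ∑ i, d i = 0)
    (A : Matrix (Fin n) (Fin n) ℂ) (hA : A.conjTranspose * A = 1) (w : Fin n → ℂ) (c : ℂ) :
    (Matrix.diagonal d * (A * (Matrix.vecMulVec w (star w) - c • 1) * A⁻¹)).trace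
      = ∑ j, d j * ‖A.mulVec w j‖ ^ 2 := by
  have hA' : A * A.conjTranspose = 1 := mul_eq_one_comm.mp hA
  rw [Matrix.inv_eq_left_inv hA, mul_sub, sub_mul, mul_sub, Matrix.trace_sub]
  rw [Matrix.mul_vecMulVec, Matrix.vecMulVec_mul, ← Matrix.star_mulVec]
  simp [hA', Matrix.trace, Matrix.vecMulVec_apply, Complex.mul_conj']
  rw [← Finset.mul_sum, hd, mul_zero]

lemma aux_diff (n : ℕ) (ψ : (Fin n → ℂ) → ℂ) (hm : AEStronglyMeasurable ψ volume) (C : ℝ)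
    (hC : ∀ w, ‖ψ w‖ ≤ C) :
    DifferentiableOn ℂ (fun z : ℂ => ∫ w : Fin n → ℂ,
      Complex.exp (-z * (∑ j, ‖w j‖ ^ 2 : ℝ)) * ψ w) {z | 0 < z.re} := by
  intro z hz
  have hz : 0 < z.re := hz
  have hC0 : 0 ≤ C := (norm_nonneg _).trans (hC 0)
  set ε := z.re / 2 with hε
  have hε0 : 0 < ε := by positivity
  have hs : {y : ℂ | ε < y.re} ∈ nhds z :=
    (isOpen_lt continuous_const Complex.continuous_re).mem_nhds (by simp [hε]; linarith)
  have hcont : ∀ y : ℂ, Continuous fun w : Fin n → ℂ =>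
      Complex.exp (-y * (∑ j, ‖w j‖ ^ 2 : ℝ)) := fun y => by fun_prop
  have hnorm : ∀ y : ℂ, ∀ w : Fin n → ℂ, ‖Complex.exp (-y * (∑ j, ‖w j‖ ^ 2 : ℝ))‖
      = Real.exp (-y.re * ∑ j, ‖w j‖ ^ 2) := by
    intro y w
    rw [Complex.norm_exp, Complex.re_mul_ofReal, Complex.neg_re]
  refine (hasDerivAt_integral_of_dominated_loc_of_deriv_le (μ := volume) (x₀ := z)
    (F := fun (z : ℂ) (w : Fin n → ℂ) => Complex.exp (-z * (∑ j, ‖w j‖ ^ 2 : ℝ)) * ψ w)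
    (F' := fun (z : ℂ) (w : Fin n → ℂ) =>
      (Complex.exp (-z * (∑ j, ‖w j‖ ^ 2 : ℝ)) * (-((∑ j, ‖w j‖ ^ 2 : ℝ) : ℂ))) * ψ w)
    (bound := fun w => 2 / ε * C * Real.exp (-(ε / 2) * ∑ j, ‖w j‖ ^ 2))
    hs ?_ ?_ ?_ ?_ ?_ ?_).2.differentiableAt.differentiableWithinAt
  · exact Filter.Eventually.of_forall fun y => (hcont y).aestronglyMeasurable.mul hm
  · refine ((aux_exp_integrable n z.re hz).mul_const C).mono'
      ((hcont z).aestronglyMeasurable.mul hm) (Filter.Eventually.of_forall fun w => ?_)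
    rw [norm_mul, hnorm]
    gcongr
    exact hC w
  · exact (Continuous.aestronglyMeasurable (by fun_prop)).mul hm
  · refine Filter.Eventually.of_forall fun w y hy => ?_
    have hy : ε < y.re := hy
    have hN : 0 ≤ ∑ j, ‖w j‖ ^ 2 := by positivity
    rw [norm_mul, norm_mul, hnorm, norm_neg, Complex.norm_real, Real.norm_of_nonneg hN]
    set N := ∑ j, ‖w j‖ ^ 2
    have h1 : Real.exp (-y.re * N) ≤ Real.exp (-(ε/2) * N) * Real.exp (-(ε / 2) * N) := by
      rw [← Real.exp_add, Real.exp_le_exp]; nlinarith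
    have h2 : Real.exp (-(ε / 2) * N) * N ≤ 2 / ε := by
      have h3 := Real.add_one_le_exp ((ε / 2) * N)
      rw [neg_mul, Real.exp_neg, inv_mul_le_iff₀ (Real.exp_pos _), mul_comm,
        div_mul_eq_mul_div, le_div_iff₀ hε0]
      linarith
    calc _ ≤ (Real.exp (-(ε/2) * N) * Real.exp (-(ε / 2) * N)) * N * C := by
            gcongr; exact hC w
      _ = Real.exp (-(ε/2) * N) * (Real.exp (-(ε / 2) * N) * N) * C := by ring
      _ ≤ Real.exp (-(ε/2) * N) * (2 / ε) * C := by gcongr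
      _ = _ := by ring
  · exact (aux_exp_integrable n (ε / 2) (by positivity)).const_mul _
  · refine Filter.Eventually.of_forall fun w y hy => ?_
    refine HasDerivAt.mul_const ?_ _
    apply HasDerivAt.cexp
    generalize ((∑ j, ‖w j‖ ^ 2 : ℝ) : ℂ) = N
    simpa using (hasDerivAt_id y).neg.mul_const N

section
set_option linter.unusedSectionVars false
variable {n : ℕ} [MeasurableSpace (Matrix.specialUnitaryGroup (Fin n) ℂ)]
    [BorelSpace (Matrix.specialUnitaryGroup (Fin n) ℂ)]
    (μ : Measure (Matrix.specialUnitaryGroup (Fin n) ℂ))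
    [IsProbabilityMeasure μ] (d : Fin n → ℂ)

lemma aux_su_unit (u : Matrix.specialUnitaryGroup (Fin n) ℂ) :
    (u : Matrix (Fin n) (Fin n) ℂ).conjTranspose * (u : Matrix (Fin n) (Fin n) ℂ) = 1 := by
  have := (Matrix.mem_specialUnitaryGroup_iff.mp u.2).1
  exact Matrix.mem_unitaryGroup_iff'.mp this

lemma aux_su_det (u : Matrix.specialUnitaryGroup (Fin n) ℂ) :
    (u : Matrix (Fin n) (Fin n) ℂ).det = 1 :=
  (Matrix.mem_specialUnitaryGroup_iff.mp u.2).2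

lemma aux_second : SecondCountableTopology (Matrix.specialUnitaryGroup (Fin n) ℂ) := by
  have : SecondCountableTopology (Matrix (Fin n) (Fin n) ℂ) :=
    inferInstanceAs (SecondCountableTopology (Fin n → Fin n → ℂ))
  exact TopologicalSpace.Subtype.secondCountableTopology _

lemma aux_cont : Continuous (fun p : (Fin n → ℂ) × Matrix.specialUnitaryGroup (Fin n) ℂ =>
    Complex.exp (Complex.I * ∑ j, d j * ‖(p.2 : Matrix (Fin n) (Fin n) ℂ).mulVec p.1 j‖ ^ 2)) := by
  have h : Continuous (fun p : (Fin n → ℂ) × Matrix.specialUnitaryGroup (Fin n) ℂ =>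
      (p.2 : Matrix (Fin n) (Fin n) ℂ).mulVec p.1) :=
    (continuous_subtype_val.comp continuous_snd).matrix_mulVec continuous_fst
  have h' := fun j => (continuous_pi_iff.mp h) j
  fun_prop

lemma aux_meas : AEStronglyMeasurable (fun w : Fin n → ℂ => ∫ u, Complex.exp (Complex.I *
      ∑ j, d j * ‖(u : Matrix (Fin n) (Fin n) ℂ).mulVec w j‖ ^ 2) ∂μ) volume := by
  have := aux_second (n := n)
  exact ((aux_cont d).stronglyMeasurable.integral_prod_right').aestronglyMeasurable

lemma aux_formula (z : ℂ) (hz : ∑ j, ‖d j‖ < z.re) :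
    (∫ w : Fin n → ℂ, Complex.exp (-z * (∑ j, ‖w j‖ ^ 2 : ℝ)) * ∫ u, Complex.exp (Complex.I *
      ∑ j, d j * ‖(u : Matrix (Fin n) (Fin n) ℂ).mulVec w j‖ ^ 2) ∂μ)
    = ∏ j, (Real.pi / (z - Complex.I * d j) : ℂ) := by
  have := aux_second (n := n)
  have hdj : ∀ j, ‖d j‖ ≤ ∑ j, ‖d j‖ := fun j =>
    Finset.single_le_sum (f := fun j => ‖d j‖) (fun i _ => norm_nonneg _) (Finset.mem_univ j)
  have hb : ∀ j, 0 < (z - Complex.I * d j).re := by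
    intro j
    have h1 := Complex.re_le_norm (Complex.I * d j)
    rw [norm_mul, Complex.norm_I, one_mul] at h1
    rw [Complex.sub_re]
    linarith [hdj j]
  set G : (Fin n → ℂ) → ℂ := fun w => ∏ j, Complex.exp (-(z - Complex.I * d j) * ‖w j‖ ^ 2) with hG
  have hGc : Continuous G := by fun_prop
  have hGi : Integrable G := aux_gauss_integrable n _ hb
  have heq : ∀ (w : Fin n → ℂ) (u : Matrix.specialUnitaryGroup (Fin n) ℂ),
      Complex.exp (-z * (∑ j, ‖w j‖ ^ 2 : ℝ)) * Complex.exp (Complex.I *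
      ∑ j, d j * ‖(u : Matrix (Fin n) (Fin n) ℂ).mulVec w j‖ ^ 2)
      = G ((u : Matrix (Fin n) (Fin n) ℂ).mulVec w) := by
    intro w u
    rw [hG, ← aux_norm n _ (aux_su_unit u) w, ← Complex.exp_add]
    simp only [← Complex.exp_sum]
    congr 1
    push_cast
    rw [Finset.mul_sum, Finset.mul_sum, ← Finset.sum_add_distrib]
    exact Finset.sum_congr rfl fun j _ => by ring
  simp_rw [← integral_const_mul, heq]
  rw [integral_integral_swap]
  · have : ∀ u : Matrix.specialUnitaryGroup (Fin n) ℂ,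
        ∫ w : Fin n → ℂ, G ((u : Matrix (Fin n) (Fin n) ℂ).mulVec w) = ∫ w, G w := by
      intro u
      have hmp := aux_mp n _ (aux_su_det u)
      conv_rhs => rw [← hmp.map_eq]
      rw [integral_map hmp.aemeasurable hGc.aestronglyMeasurable]
    simp_rw [this]
    simp only [integral_const, probReal_univ, one_smul]
    exact aux_gauss_integral n _ hb
  · have hc : Continuous (fun p : (Fin n → ℂ) × Matrix.specialUnitaryGroup (Fin n) ℂ =>
      (p.2 : Matrix (Fin n) (Fin n) ℂ).mulVec p.1) :=
      (continuous_subtype_val.comp continuous_snd).matrix_mulVec continuous_fst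
    have hi : Integrable (fun p : (Fin n → ℂ) × Matrix.specialUnitaryGroup (Fin n) ℂ =>
        Real.exp (-(z.re - ∑ j, ‖d j‖) * ∑ j, ‖p.1 j‖ ^ 2)) (volume.prod μ) :=
      (aux_exp_integrable n _ (sub_pos.mpr hz)).comp_fst μ
    refine hi.mono' (hGc.comp hc).aestronglyMeasurable (Filter.Eventually.of_forall fun p => ?_)
    simp only [Function.uncurry]
    rw [← aux_norm n _ (aux_su_unit p.2) p.1]
    set v := (p.2 : Matrix (Fin n) (Fin n) ℂ).mulVec p.1
    rw [hG]
    simp only [← Complex.exp_sum, Complex.norm_exp, Finset.mul_sum, Complex.re_sum]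
    rw [Real.exp_le_exp]
    refine Finset.sum_le_sum fun j _ => ?_
    rw [← Complex.ofReal_pow, Complex.re_mul_ofReal]
    gcongr
    have h1 := Complex.re_le_norm (Complex.I * d j)
    rw [norm_mul, Complex.norm_I, one_mul] at h1
    rw [Complex.neg_re, Complex.sub_re]
    linarith [hdj j]
end

/-- The bounded spherical functions on the Cartan motion group of `SL(n, ℂ)`:
for `D = diagonal d` a traceless complex diagonal matrix, the spherical function
`ψ_D(Y) = ∫_{SU(n)} exp(i tr(D (u Y u⁻¹))) dμ(u)` is bounded on the space of
traceless Hermitian matrices if and only if all the entries `d i` are real. -/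
theorem bounded_spherical_function_iff_real
    (n : ℕ) (hn : 2 ≤ n)
    [MeasurableSpace (Matrix.specialUnitaryGroup (Fin n) ℂ)]
    [BorelSpace (Matrix.specialUnitaryGroup (Fin n) ℂ)]
    (μ : Measure (Matrix.specialUnitaryGroup (Fin n) ℂ))
    [IsProbabilityMeasure μ] [μ.IsMulLeftInvariant]
    (d : Fin n → ℂ) (hd : ∑ i, d i = 0) :
    (∃ C : ℝ, ∀ Y : Matrix (Fin n) (Fin n) ℂ, Y.IsHermitian → Y.trace = 0 →
        ‖∫ u, Complex.exp (Complex.I *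
            (Matrix.diagonal d *
              ((u : Matrix (Fin n) (Fin n) ℂ) * Y *
                ((u : Matrix (Fin n) (Fin n) ℂ))⁻¹)).trace) ∂μ‖ ≤ C)
      ↔ ∀ i, (d i).im = 0 := by
  have hn0 : n ≠ 0 := by omega
  constructor
  · rintro ⟨C, hC⟩
    have hψ : ∀ w : Fin n → ℂ, ‖∫ u, Complex.exp (Complex.I *
        ∑ j, d j * ‖(u : Matrix (Fin n) (Fin n) ℂ).mulVec w j‖ ^ 2) ∂μ‖ ≤ C := by
      intro w
      have hc : ((∑ j, ‖w j‖ ^ 2 : ℝ) : ℂ) = ∑ j, w j * star (w j) := by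
        simp [Complex.mul_conj']
      have := hC (Matrix.vecMulVec w (star w) - (((∑ j, ‖w j‖ ^ 2) / n : ℝ) : ℂ) • 1) ?_ ?_
      · simpa only [aux_trace n hn0 d hd _ (aux_su_unit _)] using this
      · refine Matrix.IsHermitian.sub ?_ ?_
        · ext i j
          simp [Matrix.vecMulVec_apply, mul_comm]
        · ext i j
          by_cases h : i = j
          · simp [h]
          · simp [Matrix.one_apply, h, Ne.symm h]
      · have hn' : (n : ℂ) ≠ 0 := by exact_mod_cast hn0
        rw [Matrix.trace_sub, Matrix.trace_smul, Matrix.trace_one, Complex.ofReal_div, hc]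
        simp [Matrix.trace, Matrix.vecMulVec_apply, hn']
    have hdiff := aux_diff n _ (aux_meas μ d) C hψ
    set Lf : ℂ → ℂ := fun z : ℂ => ∫ w : Fin n → ℂ,
      Complex.exp (-z * (∑ j, ‖w j‖ ^ 2 : ℝ)) * ∫ u, Complex.exp (Complex.I *
        ∑ j, d j * ‖(u : Matrix (Fin n) (Fin n) ℂ).mulVec w j‖ ^ 2) ∂μ with hL
    have hopen : IsOpen {z : ℂ | 0 < z.re} := isOpen_lt continuous_const Complex.continuous_re
    have hpre : IsPreconnected {z : ℂ | 0 < z.re} := (convex_halfSpace_re_gt 0).isPreconnected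
    have hR0 : 0 ≤ ∑ j, ‖d j‖ := by positivity
    have hev : (fun z => (∏ j, (z - Complex.I * d j)) * Lf z)
        =ᶠ[nhds (((∑ j, ‖d j‖) + 1 : ℝ) : ℂ)] fun _ => (Real.pi : ℂ) ^ n := by
      have : {z : ℂ | ∑ j, ‖d j‖ < z.re} ∈ nhds (((∑ j, ‖d j‖) + 1 : ℝ) : ℂ) :=
        (isOpen_lt continuous_const Complex.continuous_re).mem_nhds (by
          simp only [Set.mem_ofPred_eq, Complex.ofReal_re]; linarith)
      filter_upwards [this] with z hz
      have hz : ∑ j, ‖d j‖ < z.re := hz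
      rw [hL]
      simp only []
      rw [aux_formula μ d z hz, ← Finset.prod_mul_distrib]
      rw [Finset.prod_congr rfl (g := fun _ => (Real.pi : ℂ)) ?_]
      · simp
      · intro j _
        refine mul_div_cancel₀ _ fun h0 => ?_
        have h2 : z = Complex.I * d j := sub_eq_zero.mp h0
        have h1 := Complex.re_le_norm z
        rw [h2, norm_mul, Complex.norm_I, one_mul, ← h2] at h1
        have := Finset.single_le_sum (f := fun j => ‖d j‖) (fun i _ => norm_nonneg _)
          (Finset.mem_univ j)
        linarith
    have hana : AnalyticOnNhd ℂ (fun z => (∏ j, (z - Complex.I * d j)) * Lf z)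
        {z : ℂ | 0 < z.re} :=
      DifferentiableOn.analyticOnNhd (DifferentiableOn.mul (by fun_prop) hdiff) hopen
    have hEq := hana.eqOn_of_preconnected_of_eventuallyEq analyticOnNhd_const hpre
      (z₀ := (((∑ j, ‖d j‖) + 1 : ℝ) : ℂ))
      (by simp only [Set.mem_ofPred_eq, Complex.ofReal_re]; linarith) hev
    have hnn : ∀ i ∈ Finset.univ, 0 ≤ (d i).im := by
      intro i _
      by_contra hlt
      have hmem : Complex.I * d i ∈ {z : ℂ | 0 < z.re} := by
        simpa using hlt
      have h := hEq hmem
      simp only at h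
      rw [Finset.prod_eq_zero (Finset.mem_univ i) (sub_self _), zero_mul] at h
      exact pow_ne_zero n (Complex.ofReal_ne_zero.mpr Real.pi_ne_zero) h.symm
    have hsum : ∑ i, (d i).im = 0 := by
      rw [← Complex.im_sum, hd, Complex.zero_im]
    intro i
    exact (Finset.sum_eq_zero_iff_of_nonneg hnn).mp hsum i (Finset.mem_univ i)
  · intro him
    refine ⟨1, fun Y hY _ => ?_⟩
    refine (norm_integral_le_of_norm_le_const (C := 1)
      (Filter.Eventually.of_forall fun u => ?_)).trans (by simp)
    have hu := aux_su_unit u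
    rw [Matrix.inv_eq_left_inv hu]
    set A := (u : Matrix (Fin n) (Fin n) ℂ)
    have hH : (A * Y * A.conjTranspose).IsHermitian := Matrix.isHermitian_mul_mul_conjTranspose A hY
    have him' : (Matrix.diagonal d * (A * Y * A.conjTranspose)).trace.im = 0 := by
      rw [Matrix.trace, Complex.im_sum]
      refine Finset.sum_eq_zero fun i _ => ?_
      rw [Matrix.diag_apply, Matrix.diagonal_mul, Complex.mul_im, him i]
      have := hH.apply i i
      rw [Complex.star_def, Complex.conj_eq_iff_im] at this
      simp [this]
    rw [Complex.norm_exp]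
    simp [him']
end

section
/- Assume Σ is nonempty. Let 𝔞_ℂ = ℂ ⊗ 𝔞 be the complexification of 𝔞, with ⟨·,·⟩ extended ℂ-bilinearly and W acting ℂ-linearly; set π(z) = ∏_{α ∈ Σ⁺} ⟨α, z⟩ for z ∈ 𝔞_ℂ. Let A_ξ, A_η ∈ 𝔞 with A_η ≠ 0, with ⟨α, A_η⟩ ≤ 0 for every α ∈ Σ⁺, and with ⟨α, A_ξ⟩ ≥ 0 for every α ∈ Σ⁺ satisfying ⟨α, A_η⟩ = 0; put λ₀ = A_ξ + i A_η ∈ 𝔞_ℂ. Then for every continuous function Z : 𝔞_ℂ × 𝔞 → ℂ satisfying Z(λ, H) = ( Σ_{s ∈ W} det(s) e^{i ⟨s λ, H⟩} ) / π(λ) for all λ ∈ 𝔞_ℂ with π(λ) ≠ 0 and all H ∈ 𝔞, the function H ↦ Z(λ₀, H) is unbounded on the open positive Weyl chamber 𝔞⁺. (This is Lemma 3 of the paper: the function ζ_λ(H) = Σ_{s∈W} ε(s) e^{i⟨s A_λ, H⟩} / π(A_λ), understood by continuity at λ₀ when π(λ₀) = 0, is unbounded on 𝔞⁺ whenever η₀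 ≠ 0.) -/
open scoped RealInnerProductSpace

theorem zz_sign_lemma {E : Type*} [AddCommGroup E] (P : Finset E) (s : E → E)
    (hs : ∀ x, s (s x) = x) (hsn : ∀ x, s (-x) = - s x)
    (hP : ∀ α ∈ P, s α ∈ P ∨ -s α ∈ P) (hPn : ∀ α ∈ P, -α ∉ P)
    (b : E) (hb : b ∈ P) (hsb : s b = -b) (huniq : ∀ α ∈ P, s α = -α → α = b)
    (ψ : E → ℂ) (hψ : ∀ x, ψ (-x) = - ψ x) :
    ∏ α ∈ P, ψ (s α) = - ∏ α ∈ P, ψ α := by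
  classical
  set ε : E → ℂ := fun α => if s α ∈ P then 1 else -1 with hε
  set σ : E → E := fun α => if s α ∈ P then s α else - s α with hσ
  have hσP : ∀ α ∈ P, σ α ∈ P := by
    intro α hα
    by_cases h : s α ∈ P
    · simp [hσ, h]
    · simpa [hσ, h] using (hP α hα).resolve_left h
  have hεσ : ∀ α ∈ P, ε (σ α) = ε α := by
    intro α hα
    by_cases h : s α ∈ P
    · simp [hσ, hε, h, hs, hα]
    · simp [hσ, hε, h, hs, hsn, hPn α hα]
  have hσσ : ∀ α ∈ P, σ (σ α) = α := by
    intro α hα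
    by_cases h : s α ∈ P
    · simp [hσ, h, hs, hα]
    · simp [hσ, h, hs, hsn, hPn α hα]
  have hεε : ∀ α, ε α * ε α = 1 := by
    intro α
    by_cases h : s α ∈ P <;> simp [hε, h]
  have hψσ : ∀ α ∈ P, ψ (s α) = ε α * ψ (σ α) := by
    intro α hα
    by_cases h : s α ∈ P
    · simp [hσ, hε, h]
    · simp [hσ, hε, h, hψ]
  have h1 : ∏ α ∈ P, ψ (σ α) = ∏ α ∈ P, ψ α :=
    Finset.prod_nbij' σ σ hσP hσP hσσ hσσ (fun _ _ => rfl)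
  have hσb : σ b = b := by simp [hσ, hsb, hPn b hb]
  have h2 : ∏ α ∈ P, ε α = -1 := by
    rw [← Finset.mul_prod_erase P ε hb]
    have h3 : ∏ α ∈ P.erase b, ε α = 1 := by
      refine Finset.prod_involution (fun α _ => σ α) ?_ ?_ ?_ ?_
      · intro α hα
        rw [hεσ α (Finset.mem_of_mem_erase hα), hεε]
      · intro α hα hne heq
        have hαP := Finset.mem_of_mem_erase hα
        by_cases h : s α ∈ P
        · exact hne (by simp [hε, h])
        · have : - s α = α := by simpa [hσ, h] using heq
          exact Finset.ne_of_mem_erase hα (huniq α hαP (neg_eq_iff_eq_neg.1 this))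
      · intro α hα
        have hαP := Finset.mem_of_mem_erase hα
        refine Finset.mem_erase.2 ⟨fun h => Finset.ne_of_mem_erase hα ?_, hσP α hαP⟩
        rw [← hσσ α hαP, h, hσb]
      · intro α hα
        exact hσσ α (Finset.mem_of_mem_erase hα)
    rw [h3]
    simp [hε, hsb, hPn b hb]
  rw [Finset.prod_congr rfl hψσ, Finset.prod_mul_distrib, h1, h2]
  ring

theorem zz_det_refl {E : Type*} [NormedAddCommGroup E] [InnerProductSpace ℝ E]
    [FiniteDimensional ℝ E] (s : E ≃ₗᵢ[ℝ] E) (b : E) (hb : b ≠ 0)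
    (h : ∀ x, s x = x - (2 * ⟪x, b⟫ / ⟪b, b⟫) • b) :
    LinearMap.det (s.toLinearEquiv : E →ₗ[ℝ] E) = -1 := by
  have : s = (ℝ ∙ b)ᗮ.reflection := by
    ext x
    rw [h, Submodule.reflection_orthogonal_apply, Submodule.reflection_singleton_apply,
      real_inner_self_eq_norm_sq, real_inner_comm]
    simp only [RCLike.ofReal_real_eq_id, id]
    module
  rw [this]
  have := Submodule.det_reflection (𝕜 := ℝ) (ℝ ∙ b)ᗮ
  rw [Submodule.orthogonal_orthogonal, finrank_span_singleton hb, pow_one] at this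
  exact this

/-- Antisymmetry for the whole group. -/
theorem zz_sign_group {E : Type*} [NormedAddCommGroup E] [InnerProductSpace ℝ E]
    (P : Finset E) (S : Set (E ≃ₗᵢ[ℝ] E))
    (hS : ∀ g ∈ S, LinearMap.det (g.toLinearEquiv : E →ₗ[ℝ] E) = -1 ∧
      ∀ ψ : E → ℂ, (∀ x, ψ (-x) = - ψ x) → ∏ α ∈ P, ψ (g α) = - ∏ α ∈ P, ψ α)
    (s : E ≃ₗᵢ[ℝ] E) (hs : s ∈ Subgroup.closure S) :
    ∀ ψ : E → ℂ, (∀ x, ψ (-x) = - ψ x) → ∏ α ∈ P, ψ (s α) =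
      ((LinearMap.det (s.toLinearEquiv : E →ₗ[ℝ] E) : ℝ) : ℂ) * ∏ α ∈ P, ψ α := by
  induction hs using Subgroup.closure_induction with
  | mem g hg =>
    intro ψ hψ
    rw [(hS g hg).1, (hS g hg).2 ψ hψ]; simp
  | one =>
    intro ψ hψ
    have : (((1 : E ≃ₗᵢ[ℝ] E).toLinearEquiv : E →ₗ[ℝ] E)) = LinearMap.id := rfl
    rw [this]; simp
  | mul x y hx hy ihx ihy =>
    intro ψ hψ
    have h : (((x * y).toLinearEquiv : E →ₗ[ℝ] E)) =
      (x.toLinearEquiv : E →ₗ[ℝ] E) ∘ₗ (y.toLinearEquiv : E →ₗ[ℝ] E) := rfl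
    have h2 := ihy (fun z => ψ (x z)) (by intro z; simp [hψ])
    rw [h, LinearMap.det_comp]
    calc ∏ α ∈ P, ψ ((x * y) α) = ∏ α ∈ P, ψ (x (y α)) := rfl
      _ = _ := by rw [h2, ihx ψ hψ]; push_cast; ring
  | inv x hx ih =>
    intro ψ hψ
    have h : (((x⁻¹).toLinearEquiv : E →ₗ[ℝ] E)) ∘ₗ
      (x.toLinearEquiv : E →ₗ[ℝ] E) = LinearMap.id := by
        ext z; exact x.symm_apply_apply z
    have h' := congrArg LinearMap.det h
    rw [LinearMap.det_comp, LinearMap.det_id] at h'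
    have h2 := ih (fun z => ψ (x⁻¹ z)) (by intro z; simp [hψ])
    have h3 : ∀ z, x⁻¹ (x z) = z := x.symm_apply_apply
    simp only [h3] at h2
    rw [h2, ← mul_assoc, ← Complex.ofReal_mul, h']; simp

theorem zz_recur {ι : Type*} (F : Finset ι) (θ : ι → ℝ) (N : ℕ) :
    ∃ n ≥ N, ∀ i ∈ F, 1 / 2 ≤ Real.cos (n * θ i) := by
  have h := mapClusterPt_one_atTop_pow (fun i => Circle.exp (θ i) : ι → Circle)
  have hU : {x : ι → Circle | ∀ i ∈ F, 1 / 2 < ((x i : Circle) : ℂ).re} ∈ nhds (1 : ι → Circle) := by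
    have : {x : ι → Circle | ∀ i ∈ F, 1 / 2 < ((x i : Circle) : ℂ).re} =
      ⋂ i ∈ F, {x : ι → Circle | 1 / 2 < ((x i : Circle) : ℂ).re} := by ext; simp
    rw [this]
    refine (Filter.biInter_finset_mem F).2 fun i _ => ?_
    refine IsOpen.mem_nhds (isOpen_lt continuous_const ?_) ?_
    · fun_prop
    · norm_num
  have h2 := (h.frequently hU).and_eventually (Filter.eventually_ge_atTop N)
  obtain ⟨n, hn, hN⟩ := h2.exists
  refine ⟨n, hN, fun i hi => ?_⟩
  have := hn i hi
  have h3 : ((Circle.exp (θ i) ^ n : Circle) : ℂ).re = Real.cos (n * θ i) := by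
    rw [Circle.coe_pow, Circle.coe_exp, ← Complex.exp_nat_mul, ← mul_assoc]
    have := Complex.exp_ofReal_mul_I_re (n * θ i)
    push_cast at this
    exact this
  rw [← h3]; exact this.le

/-- The function (e^{iw} - e^{-iw}) factored. -/
theorem zz_fact : ∃ h : ℂ → ℂ, Continuous h ∧ h 0 ≠ 0 ∧
    ∀ w, Complex.exp (Complex.I * w) - Complex.exp (-(Complex.I * w)) = w * h w := by
  let g : ℂ → ℂ := fun w => Complex.exp (Complex.I * w) - Complex.exp (-(Complex.I * w))
  have hg : Differentiable ℂ g := by fun_prop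
  refine ⟨dslope g 0, ?_, ?_, ?_⟩
  · rw [continuous_iff_continuousAt]
    intro x
    by_cases hx : x = 0
    · rw [hx]; exact continuousAt_dslope_same.2 (hg 0)
    · exact (continuousAt_dslope_of_ne hx).2 (hg x).continuousAt
  · rw [dslope_same]
    have : HasDerivAt g (Complex.exp (Complex.I * 0) * (Complex.I * 1) - Complex.exp (-(Complex.I * 0)) * (-(Complex.I * 1))) 0 :=
      (((hasDerivAt_id (0:ℂ)).const_mul Complex.I).cexp).sub
        (((hasDerivAt_id (0:ℂ)).const_mul Complex.I).neg.cexp)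
    rw [this.deriv]
    simp
  · intro w
    have := sub_smul_dslope g 0 w
    simp [g] at this ⊢
    exact this.symm

theorem zz_roots {E : Type*} [NormedAddCommGroup E] [InnerProductSpace ℝ E]
    (Sig P : Finset E)
    (hSig_ne : ∀ α ∈ Sig, α ≠ (0 : E))
    (refl : E → (E ≃ₗᵢ[ℝ] E))
    (hrefl : ∀ α ∈ Sig, ∀ x : E, refl α x = x - (2 * ⟪x, α⟫ / ⟪α, α⟫) • α)
    (hrefl_maps : ∀ α ∈ Sig, ∀ β ∈ Sig, refl α β ∈ Sig)
    (hcrys : ∀ α ∈ Sig, ∀ β ∈ Sig, ∃ m : ℤ, 2 * ⟪β, α⟫ / ⟪α, α⟫ = (m : ℝ))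
    (H0 : E) (hH0 : ∀ α ∈ Sig, ⟪α, H0⟫ ≠ 0)
    (hPdef : ∀ α, α ∈ P ↔ α ∈ Sig ∧ 0 < ⟪α, H0⟫ ∧ (1 / 2 : ℝ) • α ∉ Sig)
    (β : E) (hβ : β ∈ Sig) (ψ : E → ℂ) (hψ : ∀ x, ψ (-x) = - ψ x) :
    ∏ α ∈ P, ψ (refl β α) = - ∏ α ∈ P, ψ α := by
  have hip : ∀ α ∈ Sig, (⟪α, α⟫ : ℝ) ≠ 0 := fun α hα => inner_self_ne_zero.2 (hSig_ne α hα)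
  have hself : ∀ α ∈ Sig, ∀ c : ℝ, refl α (c • α) = -(c • α) := by
    intro α hα c
    rw [hrefl α hα, real_inner_smul_left]
    have : 2 * (c * (⟪α, α⟫ : ℝ)) / ⟪α, α⟫ = 2 * c := by
      have := hip α hα
      field_simp
    rw [this]; module
  have hneg : ∀ α ∈ Sig, -α ∈ Sig := by
    intro α hα
    have := hrefl_maps α hα α hα
    have h2 := hself α hα 1
    simp only [one_smul] at h2
    rwa [h2] at this
  have hinv : ∀ x, refl β (refl β x) = x := by
    intro x
    have h2 := hself β hβ 1
    simp only [one_smul] at h2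
    rw [hrefl β hβ x, map_sub, map_smul, h2, hrefl β hβ x]
    module
  -- parallel positive indivisible roots agree
  have hpar : ∀ α ∈ P, ∀ γ ∈ P, ∀ c : ℝ, α = c • γ → α = γ := by
    intro α hα γ hγ c hc
    obtain ⟨hα1, hα2, hα3⟩ := (hPdef α).1 hα
    obtain ⟨hγ1, hγ2, hγ3⟩ := (hPdef γ).1 hγ
    have hcpos : 0 < c := by
      rw [hc, real_inner_smul_left] at hα2
      exact (pos_iff_pos_of_mul_pos hα2).2 hγ2
    obtain ⟨m, hm⟩ := hcrys γ hγ1 α hα1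
    obtain ⟨n, hn⟩ := hcrys α hα1 γ hγ1
    have hg := hip γ hγ1
    have hm' : 2 * c = m := by
      rw [← hm, hc, real_inner_smul_left]; field_simp
    have hn' : 2 / c = n := by
      rw [← hn, hc, real_inner_smul_left, real_inner_smul_right]; field_simp
    have hmn : (m : ℝ) * n = 4 := by rw [← hm', ← hn']; field_simp; norm_num
    have hmn' : m * n = 4 := by exact_mod_cast hmn
    have hm0 : 0 < m := by
      have : (0 : ℝ) < m := by rw [← hm']; positivity
      exact_mod_cast this
    have hm4 : m ≤ 4 := Int.le_of_dvd (by norm_num) ⟨n, hmn'.symm⟩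
    interval_cases m
    · exfalso
      apply hγ3
      have : c = 1 / 2 := by push_cast at hm'; linarith
      rw [← this, ← hc]; exact hα1
    · have : c = 1 := by push_cast at hm'; linarith
      rw [hc, this, one_smul]
    · omega
    · exfalso
      apply hα3
      have : c = 2 := by push_cast at hm'; linarith
      rw [hc, this, smul_smul]; norm_num; exact hγ1
  -- existence
  have hex0 : ∀ β' ∈ Sig, 0 < ⟪β', H0⟫ → ∃ b ∈ P, ∃ c : ℝ, b = c • β' := by
    intro β' hβ' hpos
    by_cases h : (1 / 2 : ℝ) • β' ∈ Sig
    · refine ⟨(1 / 2 : ℝ) • β', (hPdef _).2 ⟨h, ?_, ?_⟩, _, rfl⟩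
      · rw [real_inner_smul_left]; linarith
      · intro h4
        obtain ⟨m, hm⟩ := hcrys β' hβ' _ h4
        rw [smul_smul, real_inner_smul_left] at hm
        have hg := hip β' hβ'
        have : (1 : ℝ) = 2 * m := by rw [← hm]; field_simp
        have h' : (1 : ℤ) = 2 * m := by exact_mod_cast this
        omega
    · exact ⟨β', (hPdef _).2 ⟨hβ', hpos, h⟩, 1, by simp⟩
  have hex : ∃ b ∈ P, ∃ c : ℝ, b = c • β := by
    rcases lt_or_gt_of_ne (hH0 β hβ) with h | h
    · obtain ⟨b, hb, c, hc⟩ := hex0 (-β) (hneg β hβ) (by rw [inner_neg_left]; linarith)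
      exact ⟨b, hb, -c, by rw [hc]; simp⟩
    · exact hex0 β hβ h
  obtain ⟨b, hb, c, hc⟩ := hex
  have hc0 : c ≠ 0 := by
    rintro rfl
    exact hSig_ne b ((hPdef b).1 hb).1 (by rw [hc, zero_smul])
  refine zz_sign_lemma P (refl β) hinv (fun x => map_neg _ x) ?_ ?_ b hb ?_ ?_ ψ hψ
  · intro α hα
    obtain ⟨hα1, hα2, hα3⟩ := (hPdef α).1 hα
    have h1 := hrefl_maps β hβ α hα1
    have h2 : (1 / 2 : ℝ) • (refl β α) ∉ Sig := by
      intro h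
      have := hrefl_maps β hβ _ h
      rw [map_smul, hinv] at this
      exact hα3 this
    rcases lt_or_gt_of_ne (hH0 _ h1) with h | h
    · right
      refine (hPdef _).2 ⟨hneg _ h1, by rw [inner_neg_left]; linarith, fun h' => h2 ?_⟩
      have := hneg _ h'
      rwa [smul_neg, neg_neg] at this
    · left
      exact (hPdef _).2 ⟨h1, h, h2⟩
  · intro α hα hα'
    have h1 := ((hPdef _).1 hα).2.1
    have h2 := ((hPdef _).1 hα').2.1
    rw [inner_neg_left] at h2; linarith
  · rw [hc, hself β hβ]
  · intro α hα h
    rw [hrefl β hβ] at h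
    set d := 2 * (⟪α, β⟫ : ℝ) / ⟪β, β⟫
    have h' : α = (d / 2) • β := by
      have h3 : (2 : ℝ) • α = d • β := by
        rw [sub_eq_iff_eq_add] at h
        have : α + α = d • β := by nth_rewrite 1 [h]; abel
        rw [two_smul, this]
      have h4 : α = (1 / 2 : ℝ) • ((2 : ℝ) • α) := by rw [smul_smul]; norm_num
      rw [h4, h3, smul_smul]; congr 1; ring
    refine hpar α hα b hb (d / 2 / c) ?_
    rw [h', hc, smul_smul]; congr 1; field_simp

/-- Finite differences applied to an exponential. -/
theorem zz_diff {E : Type*} [AddCommGroup E] [Module ℝ E] [DecidableEq E] (P : Finset E)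
    (L : E →ₗ[ℝ] ℂ)
    (t : ℝ) (H : E) :
    ∑ S ∈ P.powerset, (-1 : ℂ) ^ (P \ S).card *
      Complex.exp (Complex.I * L (H + t • (∑ α ∈ S, α - ∑ α ∈ P \ S, α))) =
    Complex.exp (Complex.I * L H) *
      ∏ α ∈ P, (Complex.exp (Complex.I * (t * L α)) - Complex.exp (-(Complex.I * (t * L α)))) := by
  simp only [sub_eq_add_neg (Complex.exp _) _]
  rw [Finset.prod_add, Finset.mul_sum]
  refine Finset.sum_congr rfl fun S hS => ?_
  rw [Finset.prod_neg, ← Complex.exp_sum, ← Complex.exp_sum]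
  have : Complex.I * L (H + t • (∑ α ∈ S, α - ∑ α ∈ P \ S, α)) =
    Complex.I * L H + (∑ α ∈ S, Complex.I * (t * L α) + ∑ α ∈ P \ S, -(Complex.I * (t * L α))) := by
    simp only [map_add, map_smul, map_sub, map_sum, Complex.real_smul, Finset.sum_neg_distrib,
      ← Finset.mul_sum]
    ring
  rw [this, Complex.exp_add, Complex.exp_add]
  ring

/-- The complex pairing as a linear map. -/
noncomputable def zzL {E : Type*} [NormedAddCommGroup E] [InnerProductSpace ℝ E]
    (lam : E × E) : E →ₗ[ℝ] ℂ where
  toFun H := (⟪lam.1, H⟫ : ℂ) + (⟪lam.2, H⟫ : ℂ) * Complex.I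
  map_add' x y := by simp only [inner_add_right]; push_cast; ring
  map_smul' c x := by
    simp only [real_inner_smul_right, RingHom.id_apply, Complex.real_smul]; push_cast; ring

theorem zz_key {E : Type*} [NormedAddCommGroup E] [InnerProductSpace ℝ E] [DecidableEq E]
    (P Sp : Finset E) (hPS : P ⊆ Sp) (Wf : Finset (E ≃ₗᵢ[ℝ] E))
    (hsign : ∀ s ∈ Wf, ∀ ψ : E → ℂ, (∀ x, ψ (-x) = - ψ x) →
      ((LinearMap.det (s.toLinearEquiv : E →ₗ[ℝ] E) : ℝ) : ℂ) * ∏ α ∈ P, ψ (s⁻¹ α) = ∏ α ∈ P, ψ α)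
    (h : ℂ → ℂ)
    (hh : ∀ w, Complex.exp (Complex.I * w) - Complex.exp (-(Complex.I * w)) = w * h w)
    (lam : E × E) (Zl : E → ℂ) (hπ : ∏ α ∈ Sp, zzL lam α ≠ 0)
    (hZ : ∀ H : E, Zl H = (∑ s ∈ Wf,
        ((LinearMap.det (s.toLinearEquiv : E →ₗ[ℝ] E) : ℝ) : ℂ) *
          Complex.exp (Complex.I * zzL (s lam.1, s lam.2) H)) / ∏ α ∈ Sp, zzL lam α)
    (t : ℝ) (H : E) :
    (∏ α ∈ Sp \ P, zzL lam α) * ∑ S ∈ P.powerset, (-1 : ℂ) ^ (P \ S).card *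
      Zl (H + t • (∑ α ∈ S, α - ∑ α ∈ P \ S, α)) =
    (∏ α ∈ P, (t * h (t * zzL lam α))) *
      ∑ s ∈ Wf, Complex.exp (Complex.I * zzL (s lam.1, s lam.2) H) := by
  have hsplit : (∏ α ∈ Sp \ P, zzL lam α) * ∏ α ∈ P, zzL lam α = ∏ α ∈ Sp, zzL lam α :=
    Finset.prod_sdiff hPS
  have hP0 : ∏ α ∈ P, zzL lam α ≠ 0 := by
    intro h0; rw [h0, mul_zero] at hsplit; exact hπ hsplit.symm
  apply mul_right_cancel₀ hP0
  have hN : (∏ α ∈ Sp, zzL lam α) * ∑ S ∈ P.powerset, (-1 : ℂ) ^ (P \ S).card *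
      Zl (H + t • (∑ α ∈ S, α - ∑ α ∈ P \ S, α)) =
      ∑ s ∈ Wf, ((LinearMap.det (s.toLinearEquiv : E →ₗ[ℝ] E) : ℝ) : ℂ) *
        ∑ S ∈ P.powerset, (-1 : ℂ) ^ (P \ S).card *
          Complex.exp (Complex.I * zzL (s lam.1, s lam.2)
            (H + t • (∑ α ∈ S, α - ∑ α ∈ P \ S, α))) := by
    simp only [Finset.mul_sum]
    rw [Finset.sum_comm]
    refine Finset.sum_congr rfl fun S _ => ?_
    rw [hZ, mul_left_comm, mul_div_cancel₀ _ hπ, Finset.mul_sum]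
    refine Finset.sum_congr rfl fun s _ => ?_
    ring
  have hR : (∏ α ∈ P, (t * h (t * zzL lam α))) * ∏ α ∈ P, zzL lam α =
      ∏ α ∈ P, (Complex.exp (Complex.I * (t * zzL lam α)) -
        Complex.exp (-(Complex.I * (t * zzL lam α)))) := by
    rw [← Finset.prod_mul_distrib]
    refine Finset.prod_congr rfl fun α _ => ?_
    rw [hh]; ring
  rw [mul_right_comm, hsplit, hN, mul_right_comm, hR, Finset.mul_sum]
  refine Finset.sum_congr rfl fun s hs => ?_
  rw [zz_diff]
  have hL : ∀ α, zzL (s lam.1, s lam.2) α = zzL lam (s⁻¹ α) := by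
    intro α
    have : ∀ x, (⟪s x, α⟫ : ℝ) = ⟪x, s⁻¹ α⟫ := by
      intro x
      rw [← LinearIsometryEquiv.inner_map_map s x (s⁻¹ α)]
      congr 1; exact (s.apply_symm_apply α).symm
    simp [zzL, this]
  simp only [hL _]
  rw [← hsign s hs (fun α => (Complex.exp (Complex.I * (t * zzL lam α)) -
        Complex.exp (-(Complex.I * (t * zzL lam α)))))]
  · ring
  · intro x; simp

theorem zz_core {E : Type*} [NormedAddCommGroup E] [InnerProductSpace ℝ E]
    (P Sp : Finset E) (hPS : P ⊆ Sp) (Wf : Finset (E ≃ₗᵢ[ℝ] E)) (h1W : 1 ∈ Wf)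
    (hsign : ∀ s ∈ Wf, ∀ ψ : E → ℂ, (∀ x, ψ (-x) = - ψ x) →
      ((LinearMap.det (s.toLinearEquiv : E →ₗ[ℝ] E) : ℝ) : ℂ) * ∏ α ∈ P, ψ (s⁻¹ α) = ∏ α ∈ P, ψ α)
    (H0 : E) (hH0 : ∀ α ∈ Sp, 0 < ⟪α, H0⟫)
    (Aξ Aη : E) (hAη : Aη ≠ 0)
    (hη : ∀ α ∈ Sp, ⟪α, Aη⟫ ≤ 0)
    (Z : E × E → E → ℂ)
    (hZ_cont : Continuous fun q : (E × E) × E => Z q.1 q.2)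
    (hZ : ∀ lam : E × E, ∏ α ∈ Sp, zzL lam α ≠ 0 → ∀ H : E, Z lam H = (∑ s ∈ Wf,
        ((LinearMap.det (s.toLinearEquiv : E →ₗ[ℝ] E) : ℝ) : ℂ) *
          Complex.exp (Complex.I * zzL (s lam.1, s lam.2) H)) / ∏ α ∈ Sp, zzL lam α) :
    ∀ C : ℝ, ∃ H : E, (∀ α ∈ Sp, 0 < ⟪α, H⟫) ∧ C < ‖Z (Aξ, Aη) H‖ := by
  classical
  intro C
  by_contra! hcon
  obtain ⟨h, hhc, hh0, hh⟩ := zz_fact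
  set lam0 : E × E := (Aξ, Aη) with hlam0
  -- choose t
  obtain ⟨t, ht0, ht⟩ : ∃ t : ℝ, 0 < t ∧ ∀ α ∈ P, h (t * zzL lam0 α) ≠ 0 := by
    have : ∀ᶠ t : ℝ in nhdsWithin 0 (Set.Ioi 0), ∀ α ∈ P, h (t * zzL lam0 α) ≠ 0 := by
      refine (Filter.eventually_all_finset P).2 fun α _ => ?_
      apply Filter.Eventually.filter_mono nhdsWithin_le_nhds
      have hc : Continuous fun t : ℝ => h (t * zzL lam0 α) := by fun_prop
      exact hc.continuousAt.eventually_ne (by simpa using hh0)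
    obtain ⟨t, h1, h2⟩ := (this.and self_mem_nhdsWithin).exists
    exact ⟨t, h2, h1⟩
  -- the identity at lam0
  have hid : ∀ H : E, (∏ α ∈ Sp \ P, zzL lam0 α) * ∑ S ∈ P.powerset, (-1 : ℂ) ^ (P \ S).card *
      Z lam0 (H + t • (∑ α ∈ S, α - ∑ α ∈ P \ S, α)) =
    (∏ α ∈ P, (t * h (t * zzL lam0 α))) *
      ∑ s ∈ Wf, Complex.exp (Complex.I * zzL (s lam0.1, s lam0.2) H) := by
    intro H
    let l : ℝ → E × E := fun u => (Aξ + u • H0, Aη)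
    have hlc : Continuous l := by fun_prop
    have hl0 : l 0 = lam0 := by simp [l, hlam0]
    have hev : ∀ᶠ u : ℝ in nhdsWithin 0 (Set.Ioi 0), ∏ α ∈ Sp, zzL (l u) α ≠ 0 := by
      have : ∀ᶠ u : ℝ in nhdsWithin 0 (Set.Ioi 0), ∀ α ∈ Sp, ⟪Aξ, α⟫ + u * ⟪H0, α⟫ ≠ 0 := by
        refine (Filter.eventually_all_finset Sp).2 fun α hα => ?_
        by_cases h0 : (⟪Aξ, α⟫ : ℝ) = 0
        · filter_upwards [self_mem_nhdsWithin] with u hu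
          have := hH0 α hα
          rw [real_inner_comm] at this
          rw [h0, zero_add]
          exact (mul_pos hu this).ne'
        · apply Filter.Eventually.filter_mono nhdsWithin_le_nhds
          have hc : Continuous fun u : ℝ => ⟪Aξ, α⟫ + u * ⟪H0, α⟫ := by fun_prop
          exact hc.continuousAt.eventually_ne (by simpa using h0)
      filter_upwards [this] with u hu
      refine Finset.prod_ne_zero_iff.2 fun α hα h0 => hu α hα ?_
      have := congrArg Complex.re h0
      simpa [zzL, l, inner_add_left, real_inner_smul_left] using this
    have hzc : ∀ H', Continuous fun u => Z (l u) H' := fun H' =>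
      hZ_cont.comp (hlc.prodMk continuous_const)
    have hLc : ∀ α, Continuous fun u => zzL (l u) α := by
      intro α
      simp only [zzL, l, LinearMap.coe_mk, AddHom.coe_mk]
      fun_prop
    have hLs : ∀ s : E ≃ₗᵢ[ℝ] E, Continuous fun u => zzL (s (l u).1, s (l u).2) H := by
      intro s
      simp only [zzL, l, LinearMap.coe_mk, AddHom.coe_mk]
      fun_prop
    have hcl : Continuous fun u => (∏ α ∈ Sp \ P, zzL (l u) α) *
      ∑ S ∈ P.powerset, (-1 : ℂ) ^ (P \ S).card *
        Z (l u) (H + t • (∑ α ∈ S, α - ∑ α ∈ P \ S, α)) := by fun_prop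
    have hcr : Continuous fun u => (∏ α ∈ P, (t * h (t * zzL (l u) α))) *
      ∑ s ∈ Wf, Complex.exp (Complex.I * zzL (s (l u).1, s (l u).2) H) := by fun_prop
    have h1 := (hcl.tendsto 0).mono_left (nhdsWithin_le_nhds (s := Set.Ioi 0))
    have h2 := (hcr.tendsto 0).mono_left (nhdsWithin_le_nhds (s := Set.Ioi 0))
    have := tendsto_nhds_unique_of_eventuallyEq h1 h2 (by
      filter_upwards [hev] with u hu
      exact zz_key P Sp hPS Wf hsign h hh (l u) (Z (l u)) hu (hZ (l u) hu) t H)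
    simpa only [hl0] using this
  -- choose the direction
  obtain ⟨H1, hH1, hκ⟩ : ∃ H1 : E, (∀ α ∈ Sp, 0 < ⟪α, H1⟫) ∧ ⟪Aη, H1⟫ < 0 := by
    have hpos : (0 : ℝ) < ⟪Aη, Aη⟫ := real_inner_self_pos.2 hAη
    set K : ℝ := (|⟪Aη, H0⟫| + 1) / ⟪Aη, Aη⟫ with hK
    have hKpos : 0 < K := by positivity
    refine ⟨H0 - K • Aη, fun α hα => ?_, ?_⟩
    · rw [inner_sub_right, real_inner_smul_right]
      nlinarith [hH0 α hα, hη α hα, mul_nonneg hKpos.le (neg_nonneg.2 (hη α hα))]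
    · rw [inner_sub_right, real_inner_smul_right, hK, div_mul_cancel₀ _ hpos.ne']
      linarith [le_abs_self (⟪Aη, H0⟫ : ℝ)]
  -- deep in the chamber
  have hdeep : ∀ᶠ n : ℕ in Filter.atTop, ∀ S ∈ P.powerset, ∀ α ∈ Sp,
      0 < ⟪α, (n : ℝ) • H1 + t • (∑ α ∈ S, α - ∑ α ∈ P \ S, α)⟫ := by
    refine (Filter.eventually_all_finset _).2 fun S _ =>
      (Filter.eventually_all_finset _).2 fun α hα => ?_
    simp only [inner_add_right, real_inner_smul_right α H1]
    have : Filter.Tendsto (fun n : ℕ => (n : ℝ) * ⟪α, H1⟫ +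
        ⟪α, t • (∑ α ∈ S, α - ∑ α ∈ P \ S, α)⟫) Filter.atTop Filter.atTop :=
      Filter.tendsto_atTop_add_const_right _ _
        (tendsto_natCast_atTop_atTop.atTop_mul_const (hH1 α hα))
    exact this.eventually_gt_atTop 0
  set c := ∏ α ∈ P, ((t : ℂ) * h (t * zzL lam0 α)) with hc
  have hc0 : 0 < ‖c‖ := by
    rw [norm_pos_iff]
    refine Finset.prod_ne_zero_iff.2 fun α hα => mul_ne_zero ?_ (ht α hα)
    exact_mod_cast ht0.ne'
  set Q := ∏ α ∈ Sp \ P, zzL lam0 α with hQ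
  set B := ‖Q‖ * (P.powerset.card * C) with hB
  have hbig : ∀ᶠ n : ℕ in Filter.atTop, B < ‖c‖ * (1 / 2 * Real.exp (n * -⟪Aη, H1⟫)) := by
    have h1 : Filter.Tendsto (fun n : ℕ => (n : ℝ) * -⟪Aη, H1⟫) Filter.atTop Filter.atTop :=
      tendsto_natCast_atTop_atTop.atTop_mul_const (by linarith)
    have h2 := (Real.tendsto_exp_atTop.comp h1).const_mul_atTop (r := 1 / 2) (by norm_num)
    exact (h2.const_mul_atTop hc0).eventually_gt_atTop B
  obtain ⟨N, hN⟩ := Filter.eventually_atTop.1 (hdeep.and hbig)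
  obtain ⟨n, hnN, hn⟩ := zz_recur Wf (fun s => ⟪s Aξ, H1⟫) N
  obtain ⟨hd, hb⟩ := hN n hnN
  have hup : ‖c‖ * ‖∑ s ∈ Wf, Complex.exp (Complex.I * zzL (s lam0.1, s lam0.2) ((n : ℝ) • H1))‖
      ≤ B := by
    rw [← norm_mul, ← hid, norm_mul]
    refine mul_le_mul_of_nonneg_left ?_ (norm_nonneg _)
    refine (norm_sum_le_of_le _ (n := fun _ => C) fun S hS => ?_).trans ?_
    · rw [norm_mul, norm_pow, norm_neg, norm_one, one_pow, one_mul]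
      exact hcon _ (hd S hS)
    · simp
  have hlow : 1 / 2 * Real.exp (n * -⟪Aη, H1⟫) ≤
      ‖∑ s ∈ Wf, Complex.exp (Complex.I * zzL (s lam0.1, s lam0.2) ((n : ℝ) • H1))‖ := by
    refine le_trans ?_ (Complex.re_le_norm _)
    have hre : ∀ s : E ≃ₗᵢ[ℝ] E,
        (Complex.exp (Complex.I * zzL (s lam0.1, s lam0.2) ((n : ℝ) • H1))).re =
        Real.exp (n * -⟪s Aη, H1⟫) * Real.cos (n * ⟪s Aξ, H1⟫) := by
      intro s
      rw [Complex.exp_re]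
      simp [zzL, hlam0, real_inner_smul_right]
    rw [Complex.re_sum]
    simp only [hre]
    have h1 : 1 / 2 * Real.exp (n * -⟪Aη, H1⟫) ≤
      Real.exp (n * -⟪(1 : E ≃ₗᵢ[ℝ] E) Aη, H1⟫) * Real.cos (n * ⟪(1 : E ≃ₗᵢ[ℝ] E) Aξ, H1⟫) := by
      rw [mul_comm]
      exact mul_le_mul_of_nonneg_left (hn 1 h1W) (Real.exp_pos _).le
    refine h1.trans (Finset.single_le_sum
      (f := fun s : E ≃ₗᵢ[ℝ] E => Real.exp (n * -⟪s Aη, H1⟫) * Real.cos (n * ⟪s Aξ, H1⟫))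
      (fun s hs => ?_) h1W)
    exact mul_nonneg (Real.exp_pos _).le (le_trans (by norm_num) (hn s hs))
  have := mul_le_mul_of_nonneg_left hlow hc0.le
  linarith

open scoped RealInnerProductSpace

/-- Lemma 3 of the paper. Model the complexification `𝔞_ℂ = ℂ ⊗ 𝔞` as `E × E`, a pair
`(x, y)` standing for `x + iy`, with the bilinear extension of the inner product given by
`⟪α, (x, y)⟫ = ⟪α, x⟫ + i ⟪α, y⟫` for real `α`, with `W` acting componentwise, and with
`π(z) = ∏_{α ∈ Σ⁺} ⟪α, z⟫`. Let `A_η ≠ 0`, let `-A_η` lie in the closed positive Weyl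
chamber, and let `⟪α, A_ξ⟫ ≥ 0` for every positive root `α` orthogonal to `A_η`; put
`λ₀ = A_ξ + i A_η`. Then any continuous `Z` agreeing with
`(λ, H) ↦ (Σ_{s ∈ W} det(s) e^{i ⟪s λ, H⟫}) / π(λ)` wherever `π(λ) ≠ 0` is, at `λ = λ₀`,
unbounded as a function of `H` on the open positive Weyl chamber. -/
theorem zeta_unbounded_on_chamber
    {E : Type*} [NormedAddCommGroup E] [InnerProductSpace ℝ E] [FiniteDimensional ℝ E]
    -- the root system `Σ`
    (Sig : Finset E)
    (hSig_ne : ∀ α ∈ Sig, α ≠ (0 : E))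
    (hSig_span : Submodule.span ℝ (Sig : Set E) = ⊤)
    -- the reflections `s_α(x) = x - (2⟪x,α⟫/⟪α,α⟫) α`
    (refl : E → (E ≃ₗᵢ[ℝ] E))
    (hrefl : ∀ α ∈ Sig, ∀ x : E, refl α x = x - (2 * ⟪x, α⟫ / ⟪α, α⟫) • α)
    (hrefl_maps : ∀ α ∈ Sig, ∀ β ∈ Sig, refl α β ∈ Sig)
    (hcrys : ∀ α ∈ Sig, ∀ β ∈ Sig, ∃ m : ℤ, 2 * ⟪β, α⟫ / ⟪α, α⟫ = (m : ℝ))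
    -- the Weyl group `W`
    (W : Subgroup (E ≃ₗᵢ[ℝ] E))
    (hW : W = Subgroup.closure {g : E ≃ₗᵢ[ℝ] E | ∃ α ∈ Sig, g = refl α})
    -- the simple roots `α₁, …, α_ℓ`
    {l : ℕ} (a : Fin l → E)
    (ha_mem : ∀ i, a i ∈ Sig)
    (ha_indep : LinearIndependent ℝ a)
    (ha_span : Submodule.span ℝ (Set.range a) = ⊤)
    -- integer coefficients of roots w.r.t. the simple roots, all `≥ 0` or all `≤ 0`
    (coeff : E → Fin l → ℤ)
    (hcoeff : ∀ α ∈ Sig, α = ∑ i, (coeff α i : ℝ) • a i ∧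
        ((∀ i, 0 ≤ coeff α i) ∨ (∀ i, coeff α i ≤ 0)))
    -- the positive roots `Σ⁺`
    (Sigplus : Finset E)
    (hSigplus : ∀ α : E, α ∈ Sigplus ↔ α ∈ Sig ∧ ∀ i, 0 ≤ coeff α i)
    (hSig_nonempty : Sig.Nonempty)
    (hW_fin : (W : Set (E ≃ₗᵢ[ℝ] E)).Finite)
    (Aξ Aη : E) (hAη : Aη ≠ 0)
    (hη : ∀ α ∈ Sigplus, ⟪α, Aη⟫ ≤ 0)
    (hξ : ∀ α ∈ Sigplus, ⟪α, Aη⟫ = 0 → 0 ≤ ⟪α, Aξ⟫)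
    (Z : E × E → E → ℂ)
    (hZ_cont : Continuous fun q : (E × E) × E => Z q.1 q.2)
    (hZ : ∀ lam : E × E,
      (∏ α ∈ Sigplus, ((⟪α, lam.1⟫ : ℂ) + (⟪α, lam.2⟫ : ℂ) * Complex.I)) ≠ 0 →
      ∀ H : E, Z lam H =
        (∑ s ∈ hW_fin.toFinset,
            ((LinearMap.det (s.toLinearEquiv : E →ₗ[ℝ] E) : ℝ) : ℂ) *
              Complex.exp (Complex.I * ((⟪s lam.1, H⟫ : ℂ) + (⟪s lam.2, H⟫ : ℂ) * Complex.I))) /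
          ∏ α ∈ Sigplus, ((⟪α, lam.1⟫ : ℂ) + (⟪α, lam.2⟫ : ℂ) * Complex.I)) :
    ∀ C : ℝ, ∃ H : E, (∀ α ∈ Sigplus, 0 < ⟪α, H⟫) ∧ C < ‖Z (Aξ, Aη) H‖ := by
  classical
  -- a strictly dominant vector
  obtain ⟨H0, hH0a⟩ : ∃ H0 : E, ∀ i, ⟪a i, H0⟫ = 1 := by
    let b := Module.Basis.mk ha_indep ha_span.ge
    let f : E →ₗ[ℝ] ℝ := b.constr ℝ (fun _ => (1 : ℝ))
    refine ⟨(InnerProductSpace.toDual ℝ E).symm (LinearMap.toContinuousLinearMap f), fun i => ?_⟩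
    rw [real_inner_comm, InnerProductSpace.toDual_symm_apply]
    have h1 : b i = a i := Module.Basis.mk_apply _ _ i
    rw [← h1]
    simp [f]
  have hcs : ∀ α ∈ Sig, ⟪α, H0⟫ = ((∑ i, coeff α i : ℤ) : ℝ) := by
    intro α hα
    conv_lhs => rw [(hcoeff α hα).1]
    simp [sum_inner, real_inner_smul_left, hH0a]
  have hnz : ∀ α ∈ Sig, ∃ i, coeff α i ≠ 0 := by
    intro α hα
    by_contra! h
    apply hSig_ne α hα
    rw [(hcoeff α hα).1]
    simp [h]
  have hpos : ∀ α ∈ Sigplus, 0 < ⟪α, H0⟫ := by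
    intro α hα
    obtain ⟨h1, h2⟩ := (hSigplus α).1 hα
    obtain ⟨i, hi⟩ := hnz α h1
    rw [hcs α h1]
    exact_mod_cast Finset.sum_pos' (fun j _ => h2 j) ⟨i, Finset.mem_univ i, lt_of_le_of_ne (h2 i) hi.symm⟩
  have hnegv : ∀ α ∈ Sig, α ∉ Sigplus → ⟪α, H0⟫ < 0 := by
    intro α hα hn
    have h2 : ∀ i, coeff α i ≤ 0 := by
      refine (hcoeff α hα).2.resolve_left fun h => hn ((hSigplus α).2 ⟨hα, h⟩)
    obtain ⟨i, hi⟩ := hnz α hα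
    rw [hcs α hα]
    exact_mod_cast Finset.sum_neg' (fun j _ => h2 j) ⟨i, Finset.mem_univ i, lt_of_le_of_ne (h2 i) hi⟩
  let P : Finset E := Sig.filter fun α => 0 < ⟪α, H0⟫ ∧ (1 / 2 : ℝ) • α ∉ Sig
  have hPdef : ∀ α, α ∈ P ↔ α ∈ Sig ∧ 0 < ⟪α, H0⟫ ∧ (1 / 2 : ℝ) • α ∉ Sig := by
    intro α; simp [P]
  have hPS : P ⊆ Sigplus := by
    intro α hα
    obtain ⟨h1, h2, -⟩ := (hPdef α).1 hα
    by_contra hn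
    exact absurd (hnegv α h1 hn) (not_lt.2 h2.le)
  have hne : ∀ α ∈ Sig, ⟪α, H0⟫ ≠ 0 := by
    intro α hα
    by_cases h : α ∈ Sigplus
    · exact (hpos α h).ne'
    · exact (hnegv α hα h).ne
  have hgroup : ∀ s ∈ W, ∀ ψ : E → ℂ, (∀ x, ψ (-x) = - ψ x) → ∏ α ∈ P, ψ (s α) =
      ((LinearMap.det (s.toLinearEquiv : E →ₗ[ℝ] E) : ℝ) : ℂ) * ∏ α ∈ P, ψ α := by
    intro s hs
    rw [hW] at hs
    refine zz_sign_group P _ ?_ s hs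
    rintro g ⟨β, hβ, rfl⟩
    exact ⟨zz_det_refl _ β (hSig_ne β hβ) (hrefl β hβ), fun ψ hψ =>
      zz_roots Sig P hSig_ne refl hrefl hrefl_maps hcrys H0 hne hPdef β hβ ψ hψ⟩
  have hL : ∀ (lam : E × E) (α : E),
      zzL lam α = (⟪α, lam.1⟫ : ℂ) + (⟪α, lam.2⟫ : ℂ) * Complex.I := by
    intro lam α
    rw [real_inner_comm, real_inner_comm lam.2]; rfl
  refine zz_core P Sigplus hPS hW_fin.toFinset ?_ ?_ H0 hpos Aξ Aη hAη hη Z hZ_cont ?_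
  · simpa using W.one_mem
  · intro s hs ψ hψ
    have hsW : s ∈ W := by simpa using hs
    have h2 := hgroup s hsW (fun z => ψ (s⁻¹ z)) (by intro z; simp [hψ])
    have h3 : ∀ z, s⁻¹ (s z) = z := s.symm_apply_apply
    simp only [h3] at h2
    exact h2.symm
  · intro lam h0 H
    simp only [hL lam] at h0 ⊢
    exact hZ lam h0 H
end
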